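/- Let η₀ ∈ (π/2, π), α ∈ (1, 2), and t > 0. Then ∫_{1/t}^∞ e^{s t cos η₀} s^{α-1} ds ≤ (e^{cos η₀}/|cos η₀|) · (1 + (α-1)/|cos η₀|) · t^{-α}. Consequently there is a constant K (depending only on η₀ and α) with ∫_{1/t}^∞ e^{s t cos η₀} s^{α-1} ds ≤ K t^{-α}. -/

import Mathlib

open Real MeasureTheory

/-- An exponentially decaying affine function which is nonnegative on `(a, ∞)` is integrable there,
with an explicit integral. -/
theorem integrableOn_and_integral_Ioi_exp_mul_affine {a c p q : ℝ} (hc : c < 0)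
    (hpos : ∀ s ∈ Set.Ioi a, 0 ≤ p + q * s) :
    IntegrableOn (fun s => exp (c * s) * (p + q * s)) (Set.Ioi a) ∧
      ∫ s in Set.Ioi a, exp (c * s) * (p + q * s) =
        exp (c * a) / (-c) * (p + q * a + q / (-c)) := by
  have hderiv : ∀ s ∈ Set.Ici a,
      HasDerivAt (fun s => exp (c * s) / c * (p + q * s - q / c))
        (exp (c * s) * (p + q * s)) s := by
    intro s _
    have hlin (r : ℝ) : HasDerivAt (fun s => r * s) r s := by
      simpa using (hasDerivAt_id s).const_mul r
    refine (((hlin c).exp.div_const c).mul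
      (((hlin q).const_add p).sub_const (q / c))).congr_deriv ?_
    field_simp [hc.ne]
    ring
  have hnonneg : ∀ s ∈ Set.Ioi a, 0 ≤ exp (c * s) * (p + q * s) := fun s hs =>
    mul_nonneg (exp_pos _).le (hpos s hs)
  have hlim : Filter.Tendsto (fun s => exp (c * s) / c * (p + q * s - q / c))
      Filter.atTop (nhds 0) := by
    have hexp := tendsto_rpow_mul_exp_neg_mul_atTop_nhds_zero 0 (-c) (neg_pos.2 hc)
    have hmul := tendsto_rpow_mul_exp_neg_mul_atTop_nhds_zero 1 (-c) (neg_pos.2 hc)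
    simp only [rpow_zero, rpow_one, one_mul, neg_neg] at hexp hmul
    have hsum := (hexp.const_mul ((p - q / c) / c)).add (hmul.const_mul (q / c))
    simp only [mul_zero, add_zero] at hsum
    refine hsum.congr fun s => ?_
    ring
  refine ⟨integrableOn_Ioi_deriv_of_nonneg' hderiv hnonneg hlim, ?_⟩
  rw [integral_Ioi_of_hasDerivAt_of_nonneg' hderiv hnonneg hlim]
  simp only [div_neg]
  ring

/-- An upper incomplete Gamma type bound for exponents in `[1, 2]`. -/
theorem integral_Ioi_exp_mul_rpow_le {c α t : ℝ} (hc : c < 0) (hα₁ : 1 ≤ α) (hα₂ : α ≤ 2)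
    (ht : 0 < t) :
    ∫ s in Set.Ioi (1 / t), exp (s * t * c) * s ^ (α - 1) ≤
      exp c / |c| * (1 + (α - 1) / |c|) * t ^ (-α) := by
  have hbern : ∀ s ∈ Set.Ioi (1 / t),
      s ^ (α - 1) ≤ t ^ (1 - α) * ((2 - α) + (α - 1) * t * s) := by
    intro s hs
    have hs₀ : 0 < s := (one_div_pos.2 ht).trans hs
    have h := rpow_one_add_le_one_add_mul_self (s := s * t - 1)
      (by linarith [mul_pos hs₀ ht]) (p := α - 1) (by linarith) (by linarith)
    rw [add_sub_cancel, mul_rpow hs₀.le ht.le] at h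
    calc s ^ (α - 1) = t ^ (1 - α) * (s ^ (α - 1) * t ^ (α - 1)) := by
          rw [mul_left_comm, ← rpow_add ht]; simp
      _ ≤ t ^ (1 - α) * (1 + (α - 1) * (s * t - 1)) := by gcongr
      _ = _ := by ring
  have hpos : ∀ s ∈ Set.Ioi (1 / t), 0 ≤ (2 - α) + (α - 1) * t * s := by
    intro s hs
    have hs₀ : 0 < s := (one_div_pos.2 ht).trans hs
    have := mul_nonneg (mul_nonneg (sub_nonneg.2 hα₁) ht.le) hs₀.le
    linarith
  obtain ⟨hint, hval⟩ := integrableOn_and_integral_Ioi_exp_mul_affine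
    (mul_neg_of_pos_of_neg ht hc) hpos
  calc ∫ s in Set.Ioi (1 / t), exp (s * t * c) * s ^ (α - 1)
      ≤ ∫ s in Set.Ioi (1 / t),
          t ^ (1 - α) * (exp (t * c * s) * ((2 - α) + (α - 1) * t * s)) := by
        refine integral_mono_of_nonneg ?_ (hint.const_mul _) ?_
        · filter_upwards [ae_restrict_mem measurableSet_Ioi] with s hs
          exact mul_nonneg (exp_pos _).le (rpow_nonneg ((one_div_pos.2 ht).trans hs).le _)
        · filter_upwards [ae_restrict_mem measurableSet_Ioi] with s hs
          calc exp (s * t * c) * s ^ (α - 1)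
              ≤ exp (s * t * c) * (t ^ (1 - α) * ((2 - α) + (α - 1) * t * s)) := by
                gcongr
                exact hbern s hs
            _ = _ := by rw [show s * t * c = t * c * s by ring]; ring
    _ = exp c / |c| * (1 + (α - 1) / |c|) * t ^ (-α) := by
        have hexp : t * c * (1 / t) = c := by field_simp
        have hpow : t ^ (1 - α) = t * t ^ (-α) := by
          rw [sub_eq_add_neg, rpow_add ht, rpow_one]
        rw [integral_const_mul, hval, hexp, hpow, abs_of_neg hc]
        field_simp [hc.ne]
        ring

theorem stmt_3 (η₀ α : ℝ) (hη : η₀ ∈ Set.Ioo (Real.pi / 2) Real.pi)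
    (hα : α ∈ Set.Ioo (1 : ℝ) 2) :
    (∀ t : ℝ, 0 < t →
      (∫ s in Set.Ioi (1 / t), Real.exp (s * t * Real.cos η₀) * s ^ (α - 1))
        ≤ (Real.exp (Real.cos η₀) / |Real.cos η₀|) * (1 + (α - 1) / |Real.cos η₀|)
            * t ^ (-α)) ∧
    ∃ K : ℝ, ∀ t : ℝ, 0 < t →
      (∫ s in Set.Ioi (1 / t), Real.exp (s * t * Real.cos η₀) * s ^ (α - 1))
        ≤ K * t ^ (-α) := by
  have hcos : cos η₀ < 0 :=
    cos_neg_of_pi_div_two_lt_of_lt hη.1 (by linarith [hη.2, pi_pos])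
  have hbound := fun (t : ℝ) (ht : 0 < t) =>
    integral_Ioi_exp_mul_rpow_le hcos hα.1.le hα.2.le ht
  exact ⟨hbound, _, hbound⟩
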